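/- Let X be a finite 2-dimensional simplicial complex containing the vertices 1, 2, 3 and suppose there are three further distinct vertices a, b, c of X (distinct from 1, 2, 3) such that {1,a}, {a,2}, {2,b}, {b,3}, {3,c}, {c,1} are all edges of X. If e^0_1X_3 > 1/3, then the loop in the geometric realization |X| that traverses the straight-line segments of this hexagon 1, a, 2, b, 3, c in cyclic order is not nullhomotopic in |X|. -/

import Mathlib

open scoped BigOperators

/-- A finite 2-dimensional abstract simplicial complex on vertex set `Fin N`
(vertex `i ∈ {1,…,N}` corresponds to the element of `Fin N` with value `i-1`). -/
structure SimplicialComplex2 (N : ℕ) where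
  faces : Finset (Finset (Fin N))
  nonempty_of_mem : ∀ σ ∈ faces, σ.Nonempty
  card_le_three : ∀ σ ∈ faces, σ.card ≤ 3
  down_closed : ∀ σ ∈ faces, ∀ τ ⊆ σ, τ.Nonempty → τ ∈ faces

namespace SimplicialComplex2

variable {N : ℕ}

/-- `f i X` is the number of `i`-dimensional faces of `X`. -/
def f (i : ℕ) (X : SimplicialComplex2 N) : ℕ :=
  (X.faces.filter fun σ => σ.card = i + 1).card

/-- The Euler characteristic `χX = f⁰X − f¹X + f²X`. -/
def euler (X : SimplicialComplex2 N) : ℤ :=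
  (f 0 X : ℤ) - f 1 X + f 2 X

/-- `Y` is a subcomplex of `X`. -/
def IsSubcomplex (Y X : SimplicialComplex2 N) : Prop :=
  Y.faces ⊆ X.faces

/-- The `i`-th standard basis vector of `ℝ^N`. -/
def basisVec (i : Fin N) : Fin N → ℝ := Pi.single i 1

/-- The geometric realization of `X` as a subset of `ℝ^N`: the union over the
faces `σ` of `X` of the convex hulls of the corresponding sets of standard basis
vectors. -/
def realization (X : SimplicialComplex2 N) : Set (Fin N → ℝ) :=
  ⋃ σ ∈ X.faces, convexHull ℝ (basisVec '' (σ : Set (Fin N)))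

lemma vertex_mem_realization (X : SimplicialComplex2 N) {x : Fin N}
    (hx : {x} ∈ X.faces) : basisVec x ∈ realization X := by
  refine Set.mem_biUnion hx ?_
  exact subset_convexHull ℝ _ ⟨x, by simp⟩

/-- The point of the realization corresponding to a vertex. -/
def vertexPt (X : SimplicialComplex2 N) {x : Fin N} (hx : {x} ∈ X.faces) :
    ↥(realization X) :=
  ⟨basisVec x, X.vertex_mem_realization hx⟩

end SimplicialComplex2

namespace SimplicialComplex2

variable {N : ℕ}

lemma edge_fst_mem (X : SimplicialComplex2 N) {u v : Fin N}
    (h : ({u, v} : Finset (Fin N)) ∈ X.faces) : ({u} : Finset (Fin N)) ∈ X.faces :=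
  X.down_closed _ h {u} (by simp) ⟨u, Finset.mem_singleton_self u⟩

lemma edge_snd_mem (X : SimplicialComplex2 N) {u v : Fin N}
    (h : ({u, v} : Finset (Fin N)) ∈ X.faces) : ({v} : Finset (Fin N)) ∈ X.faces :=
  X.down_closed _ h {v} (by simp) ⟨v, Finset.mem_singleton_self v⟩

lemma segPoint_mem (X : SimplicialComplex2 N) {u v : Fin N}
    (h : ({u, v} : Finset (Fin N)) ∈ X.faces) (t : ℝ) (ht0 : 0 ≤ t) (ht1 : t ≤ 1) :
    (1 - t) • basisVec u + t • basisVec v ∈ realization X := by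
  refine Set.mem_biUnion h ?_
  have hu : basisVec u ∈ basisVec '' (({u, v} : Finset (Fin N)) : Set (Fin N)) :=
    ⟨u, by simp, rfl⟩
  have hv : basisVec v ∈ basisVec '' (({u, v} : Finset (Fin N)) : Set (Fin N)) :=
    ⟨v, by simp, rfl⟩
  refine segment_subset_convexHull hu hv ?_
  exact ⟨1 - t, t, by linarith, ht0, by ring, rfl⟩

/-- The straight-line path in the realization along an edge `{u,v}`, from the
vertex `u` to the vertex `v`. -/
noncomputable def edgePath (X : SimplicialComplex2 N) (u v : Fin N)
    (h : ({u, v} : Finset (Fin N)) ∈ X.faces) :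
    Path (vertexPt X (edge_fst_mem X h)) (vertexPt X (edge_snd_mem X h)) where
  toFun t := ⟨(1 - (t : ℝ)) • basisVec u + (t : ℝ) • basisVec v,
    segPoint_mem X h t t.2.1 t.2.2⟩
  continuous_toFun := by
    refine Continuous.subtype_mk ?_ _
    fun_prop
  source' := by
    apply Subtype.ext
    simp [vertexPt]
  target' := by
    apply Subtype.ext
    simp [vertexPt]

/-- The loop traversing the straight-line segments of the hexagon
`p, a, q, b, r, c` in cyclic order. -/
noncomputable def hexLoop (X : SimplicialComplex2 N) (p q r a b c : Fin N)
    (h1 : ({p, a} : Finset (Fin N)) ∈ X.faces)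
    (h2 : ({a, q} : Finset (Fin N)) ∈ X.faces)
    (h3 : ({q, b} : Finset (Fin N)) ∈ X.faces)
    (h4 : ({b, r} : Finset (Fin N)) ∈ X.faces)
    (h5 : ({r, c} : Finset (Fin N)) ∈ X.faces)
    (h6 : ({c, p} : Finset (Fin N)) ∈ X.faces) :
    Path (vertexPt X (edge_fst_mem X h1)) (vertexPt X (edge_fst_mem X h1)) :=
  (edgePath X p a h1).trans ((edgePath X a q h2).trans ((edgePath X q b h3).trans
    ((edgePath X b r h4).trans ((edgePath X r c h5).trans (edgePath X c p h6)))))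

end SimplicialComplex2


namespace SimplicialComplex2

section Winding

variable {Z : Type*} [TopologicalSpace Z] (F : C(Z, AddCircle (1 : ℝ))) {x y z : Z}

/-- Some lift to `ℝ` of the image under `F` of the path `γ` increases by `r` in total. -/
def HasIncrement (γ : Path x y) (r : ℝ) : Prop :=
  ∃ g : C(unitInterval, ℝ), g 1 - g 0 = r ∧ ∀ t, (g t : AddCircle (1 : ℝ)) = F (γ t)

variable {F}

lemma HasIncrement.trans {γ : Path x y} {γ' : Path y z} {r r' : ℝ}
    (h : HasIncrement F γ r) (h' : HasIncrement F γ' r') :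
    HasIncrement F (γ.trans γ') (r + r') := by
  obtain ⟨g, hg, hgF⟩ := h
  obtain ⟨g', hg', hgF'⟩ := h'
  have hends : ((g 1 - g' 0 : ℝ) : AddCircle (1 : ℝ)) = 0 := by
    rw [AddCircle.coe_sub, hgF, hgF', γ.target, γ'.source, sub_self]
  let p : Path (g 0) (g 1) := ⟨g, rfl, rfl⟩
  let q : Path (g 1) (g' 1 + (g 1 - g' 0)) :=
    ⟨⟨fun t => g' t + (g 1 - g' 0), by fun_prop⟩, by simp, rfl⟩
  refine ⟨(p.trans q).toContinuousMap, ?_, fun t => ?_⟩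
  · have h0 := (p.trans q).source
    have h1 := (p.trans q).target
    change (p.trans q) 1 - (p.trans q) 0 = _
    rw [h0, h1]
    linarith
  · change (((p.trans q) t : ℝ) : AddCircle (1 : ℝ)) = _
    rw [Path.trans_apply, Path.trans_apply]
    split_ifs
    · exact hgF _
    · change ((g' _ + (g 1 - g' 0) : ℝ) : AddCircle (1 : ℝ)) = _
      rw [AddCircle.coe_add, hends, add_zero]
      exact hgF' _

lemma HasIncrement.eq_zero_of_homotopic_refl {γ : Path x x} {r : ℝ}
    (h : HasIncrement F γ r) (hγ : γ.Homotopic (Path.refl x)) : r = 0 := by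
  obtain ⟨g, rfl, hgF⟩ := h
  have cov := AddCircle.isCoveringMap_coe (1 : ℝ)
  obtain ⟨H⟩ := hγ
  have hrel : (F.comp γ.toContinuousMap).HomotopicRel
      (F.comp (Path.refl x).toContinuousMap) {0, 1} := ⟨H.compContinuousMap F⟩
  have h0 : (F.comp γ.toContinuousMap) 0 = (g 0 : AddCircle (1 : ℝ)) := (hgF 0).symm
  have h0' : (F.comp (Path.refl x).toContinuousMap) 0 = (g 0 : AddCircle (1 : ℝ)) := by
    rw [hgF, γ.source]; rfl
  have key := cov.liftPath_apply_one_eq_of_homotopicRel hrel (g 0) h0 h0'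
  rw [← (cov.eq_liftPath_iff' h0 (Γ := g)).mpr ⟨funext hgF, rfl⟩,
    ← (cov.eq_liftPath_iff' h0' (Γ := .const _ (g 0))).mpr ⟨funext fun t => h0'.symm, rfl⟩] at key
  rw [key]
  simp

end Winding

variable {N : ℕ}

/-- A cocycle on the edges of `X` with values in `ℝ`. -/
structure IsCocycle (X : SimplicialComplex2 N) (φ : Fin N → Fin N → ℝ) : Prop where
  self : ∀ u, φ u u = 0
  add : ∀ u v w, ({u, v, w} : Finset (Fin N)) ∈ X.faces → φ u v + φ v w = φ u w
  int : ∀ u v, ∃ n : ℤ, φ u v = n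

lemma sum_eq_one_of_mem_convexHull {σ : Finset (Fin N)} {x : Fin N → ℝ}
    (hx : x ∈ convexHull ℝ (basisVec '' (σ : Set (Fin N)))) :
    ∑ i, x i = 1 ∧ ∀ i ∉ σ, x i = 0 := by
  have hconv : Convex ℝ {x : Fin N → ℝ | ∑ i, x i = 1 ∧ ∀ i ∉ σ, x i = 0} := by
    rintro x ⟨hx1, hx2⟩ y ⟨hy1, hy2⟩ s t - - hst
    refine ⟨?_, fun i hi => by simp [hx2 i hi, hy2 i hi]⟩
    simp [Finset.sum_add_distrib, ← Finset.mul_sum, hx1, hy1, hst]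
  refine convexHull_min ?_ hconv hx
  rintro _ ⟨j, hj, rfl⟩
  refine ⟨by simp [basisVec], fun i hi => ?_⟩
  have : i ≠ j := fun h => hi (h ▸ hj)
  simp [basisVec, this]

variable {X : SimplicialComplex2 N} {φ : Fin N → Fin N → ℝ}

lemma exists_face (x : realization X) :
    ∃ σ ∈ X.faces, ∑ i, x.1 i = 1 ∧ ∀ i ∉ σ, x.1 i = 0 := by
  obtain ⟨σ, hσ, hx⟩ := Set.mem_iUnion₂.mp x.2
  exact ⟨σ, hσ, sum_eq_one_of_mem_convexHull hx⟩

lemma exists_coord_ne_zero (x : realization X) : ∃ i, x.1 i ≠ 0 := by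
  obtain ⟨σ, -, h, -⟩ := exists_face x
  by_contra! h0
  simp [h0] at h

/-- The map to the circle that winds `φ u v` times around along the edge from `u` to `v`. -/
noncomputable def circleFun (φ : Fin N → Fin N → ℝ) (x : realization X) : AddCircle (1 : ℝ) :=
  ((∑ i, x.1 i * φ (exists_coord_ne_zero x).choose i : ℝ) : AddCircle (1 : ℝ))

lemma circleFun_eq (hφ : X.IsCocycle φ) {σ : Finset (Fin N)} (hσ : σ ∈ X.faces)
    {x : realization X} (hx : ∀ i ∉ σ, x.1 i = 0) {v : Fin N} (hv : v ∈ σ) :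
    circleFun φ x = ((∑ i, x.1 i * φ v i : ℝ) : AddCircle (1 : ℝ)) := by
  obtain ⟨-, -, hsum, -⟩ := exists_face x
  unfold circleFun
  have hu := (exists_coord_ne_zero x).choose_spec
  set u := (exists_coord_ne_zero x).choose
  have huσ : u ∈ σ := by_contra fun h => hu (hx u h)
  obtain ⟨n, hn⟩ := hφ.int v u
  have hterm : ∀ i, x.1 i * φ v i = x.1 i * n + x.1 i * φ u i := fun i => by
    by_cases hi : i ∈ σ
    · have : ({v, u, i} : Finset (Fin N)) ∈ X.faces :=
        X.down_closed σ hσ _ (by simp [Finset.insert_subset_iff, *]) (by simp)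
      rw [← hφ.add v u i this, hn]
      ring
    · simp [hx i hi]
  rw [Finset.sum_congr rfl fun i _ => hterm i, Finset.sum_add_distrib, ← Finset.sum_mul, hsum,
    one_mul, AddCircle.coe_add]
  have : ((n : ℝ) : AddCircle (1 : ℝ)) = 0 := AddCircle.coe_eq_zero_iff _ |>.mpr ⟨n, by simp⟩
  rw [this, zero_add]

lemma continuous_circleFun (hφ : X.IsCocycle φ) :
    Continuous (circleFun φ : realization X → AddCircle (1 : ℝ)) := by
  have hcoord (i : Fin N) : Continuous fun x : realization X => x.1 i :=
    (continuous_apply i).comp continuous_subtype_val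
  let C : X.faces → Set (realization X) := fun σ => {x | ∀ i ∉ σ.1, x.1 i = 0}
  refine (locallyFinite_of_finite C).continuous ?_ ?_ ?_
  · refine Set.eq_univ_of_forall fun x => ?_
    obtain ⟨σ, hσ, -, hx⟩ := exists_face x
    exact Set.mem_iUnion.mpr ⟨⟨σ, hσ⟩, hx⟩
  · intro σ
    simp only [C, Set.ofPred_forall]
    exact isClosed_iInter fun i => isClosed_iInter fun _ =>
      isClosed_eq (hcoord i) continuous_const
  · rintro ⟨σ, hσ⟩
    obtain ⟨v, hv⟩ := X.nonempty_of_mem σ hσ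
    have hcont : Continuous fun x : realization X =>
        ((∑ i, x.1 i * φ v i : ℝ) : AddCircle (1 : ℝ)) :=
      (AddCircle.continuous_mk' 1).comp <| continuous_finsetSum _ fun i _ =>
        (hcoord i).mul continuous_const
    exact hcont.continuousOn.congr fun x hx => circleFun_eq hφ hσ hx hv

lemma hasIncrement_edgePath (hφ : X.IsCocycle φ) {u v : Fin N}
    (h : ({u, v} : Finset (Fin N)) ∈ X.faces) :
    HasIncrement ⟨circleFun φ, continuous_circleFun hφ⟩ (edgePath X u v h) (φ u v) := by
  refine ⟨⟨fun t => t * φ u v, by fun_prop⟩, by simp, fun t => ?_⟩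
  have hx : ∀ i ∉ ({u, v} : Finset (Fin N)), (edgePath X u v h t).1 i = 0 := fun i hi => by
    simp only [Finset.mem_insert, Finset.mem_singleton, not_or] at hi
    simp [edgePath, basisVec, hi]
  change _ = circleFun φ _
  rw [circleFun_eq hφ h hx (Finset.mem_insert_self u _)]
  congr 1
  simp [edgePath, basisVec, add_mul, Finset.sum_add_distrib, Pi.single_apply, hφ.self]

lemma IsCocycle.hexLoop_sum_eq_zero (hφ : X.IsCocycle φ) {p q r a b c : Fin N}
    (h1 : ({p, a} : Finset (Fin N)) ∈ X.faces) (h2 : ({a, q} : Finset (Fin N)) ∈ X.faces)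
    (h3 : ({q, b} : Finset (Fin N)) ∈ X.faces) (h4 : ({b, r} : Finset (Fin N)) ∈ X.faces)
    (h5 : ({r, c} : Finset (Fin N)) ∈ X.faces) (h6 : ({c, p} : Finset (Fin N)) ∈ X.faces)
    (hnull : (hexLoop X p q r a b c h1 h2 h3 h4 h5 h6).Homotopic (Path.refl _)) :
    φ p a + (φ a q + (φ q b + (φ b r + (φ r c + φ c p)))) = 0 :=
  HasIncrement.eq_zero_of_homotopic_refl
    ((hasIncrement_edgePath hφ h1).trans <| (hasIncrement_edgePath hφ h2).trans <|
      (hasIncrement_edgePath hφ h3).trans <| (hasIncrement_edgePath hφ h4).trans <|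
      (hasIncrement_edgePath hφ h5).trans (hasIncrement_edgePath hφ h6)) hnull

end SimplicialComplex2

section Chains

open Finset

variable {V : Type*} [DecidableEq V]

/-- The oriented edge from `u` to `v` as an antisymmetric rational 1-chain. -/
def edgeChain (u v : V) : V → V → ℚ := fun x y =>
  (if x = u ∧ y = v then 1 else 0) - if x = v ∧ y = u then 1 else 0

/-- The boundary of the oriented triangle `u, v, w`. -/
def triangleChain (u v w : V) : V → V → ℚ := edgeChain u v + edgeChain v w + edgeChain w u

lemma edgeChain_swap (u v x y : V) : edgeChain u v y x = -edgeChain u v x y := by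
  simp [edgeChain, and_comm]

lemma sum_edgeChain [Fintype V] (u v y : V) :
    ∑ x, edgeChain u v x y = (if y = v then 1 else 0) - if y = u then 1 else 0 := by
  simp [edgeChain, Finset.sum_sub_distrib, ite_and]

lemma triangleChain_swap (u v w x y : V) : triangleChain u v w y x = -triangleChain u v w x y := by
  simp only [triangleChain, Pi.add_apply, edgeChain_swap _ _ x y]
  ring

lemma sum_triangleChain [Fintype V] (u v w y : V) : ∑ x, triangleChain u v w x y = 0 := by
  simp only [triangleChain, Pi.add_apply, Finset.sum_add_distrib, sum_edgeChain]
  ring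

lemma triangleChain_ne_zero_iff {u v w : V} (huv : u ≠ v) (huw : u ≠ w) (hvw : v ≠ w) (x y : V) :
    triangleChain u v w x y ≠ 0 ↔
      x ∈ ({u, v, w} : Finset V) ∧ y ∈ ({u, v, w} : Finset V) ∧ x ≠ y := by
  simp only [triangleChain, edgeChain, Pi.add_apply, Finset.mem_insert, Finset.mem_singleton]
  grind

/-- Distinct triangles with linearly independent boundaries whose combination `h` is supported on
at most six edges that belong to one component: their vertices and edges satisfy an Euler type
inequality. -/
theorem three_mul_card_vertices_le [Fintype V] (A : Finset (Finset V)) (hA : ∀ σ ∈ A, #σ = 3)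
    (β : Finset V → V → V → ℚ) (hswap : ∀ σ x y, β σ y x = -β σ x y)
    (hdiv : ∀ σ y, ∑ x, β σ x y = 0)
    (hsupp : ∀ σ ∈ A, ∀ x y, β σ x y ≠ 0 ↔ x ∈ σ ∧ y ∈ σ ∧ x ≠ y)
    (hind : ∀ t : Finset V → ℚ, ∑ σ ∈ A, t σ • β σ = 0 → ∀ σ ∈ A, t σ = 0)
    (c : Finset V → ℚ) (hc : ∀ σ ∈ A, c σ ≠ 0)
    (h : V → V → ℚ) (hh : ∑ σ ∈ A, c σ • β σ = h)
    (H : Finset (Finset V)) (hH : #H ≤ 6) (hhH : ∀ x y, h x y ≠ 0 → {x, y} ∈ H)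
    (p : V) (hconn : ∀ g : V → ℚ, (∀ x y, h x y ≠ 0 → g x = g y) → ∀ x y, h x y ≠ 0 → g x = g p) :
    3 * #(A.biUnion id) ≤ #(A.biUnion (powersetCard 2)) + 9 := by
  set E := A.biUnion (powersetCard 2) with hE
  have mem_E : ∀ e, e ∈ E ↔ ∃ σ ∈ A, e ⊆ σ ∧ #e = 2 := by simp [hE, mem_powersetCard]
  have pair_mem : ∀ σ ∈ A, ∀ x y, x ∈ σ → y ∈ σ → x ≠ y → ({x, y} : Finset V) ∈ E :=
    fun σ hσ x y hx hy hxy => (mem_E _).2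
      ⟨σ, hσ, by simp [insert_subset_iff, hx, hy], card_pair hxy⟩
  -- a function that is constant along the edges is constant
  have hconst : ∀ g : V → ℚ, (∀ x y, {x, y} ∈ E → g x = g y) → g p = 0 →
      ∀ σ ∈ A, ∀ x ∈ σ, g x = 0 := by
    intro g hg hgp σ hσ x hx
    have hgh : ∀ x y, h x y ≠ 0 → g x = 0 := by
      intro x y hxy
      rw [← hgp]
      refine hconn g (fun x y hxy => ?_) x y hxy
      rw [← hh, Finset.sum_apply, Finset.sum_apply] at hxy
      obtain ⟨τ, hτ, hne⟩ := exists_ne_zero_of_sum_ne_zero hxy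
      have hβ : β τ x y ≠ 0 := fun h0 => hne (by simp [h0])
      obtain ⟨h1, h2, h3⟩ := (hsupp τ hτ x y).1 hβ
      exact hg x y (pair_mem τ hτ x y h1 h2 h3)
    let G : Finset V → ℚ := fun τ => if hτ : τ.Nonempty then g hτ.choose else 0
    have hG : ∀ τ ∈ A, ∀ x ∈ τ, G τ = g x := by
      intro τ hτ x hx
      have hne : τ.Nonempty := ⟨x, hx⟩
      simp only [G, dif_pos hne]
      by_cases hxc : hne.choose = x
      · rw [hxc]
      · exact hg _ _ (pair_mem τ hτ _ _ hne.choose_spec hx hxc)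
    have hzero : ∑ τ ∈ A, (G τ * c τ) • β τ = 0 := by
      funext x y
      have hterm : ∀ τ ∈ A, ((G τ * c τ) • β τ) x y = g x * (c τ • β τ) x y := by
        intro τ hτ
        by_cases hβ : β τ x y = 0
        · simp [hβ]
        · simp [hG τ hτ x ((hsupp τ hτ x y).1 hβ).1, mul_assoc]
      rw [Finset.sum_apply, Finset.sum_apply, sum_congr rfl hterm, ← mul_sum]
      have : ∑ τ ∈ A, (c τ • β τ) x y = h x y := by rw [← hh, Finset.sum_apply, Finset.sum_apply]
      rw [this]
      by_cases hxy : h x y = 0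
      · simp [hxy]
      · simp [hgh x y hxy]
    rw [← hG σ hσ x hx]
    exact (mul_eq_zero.1 (hind _ hzero σ hσ)).resolve_right (hc σ hσ)
  -- Euler characteristic
  have heuler : #A + #(A.biUnion id) ≤ #E + 1 := by
    have hrep : ∀ e : E, ∃ q : V × V, q.1 ≠ q.2 ∧ e.1 = {q.1, q.2} := by
      rintro ⟨e, he⟩
      obtain ⟨σ, -, -, h2⟩ := (mem_E e).1 he
      obtain ⟨x, y, hxy, rfl⟩ := card_eq_two.1 h2
      exact ⟨(x, y), hxy, rfl⟩
    choose q hq hqe using hrep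
    let B : (A → ℚ) →ₗ[ℚ] (V → V → ℚ) := ∑ σ : A, (LinearMap.proj σ).smulRight (β σ)
    let ev (x : V) : (V → ℚ) →ₗ[ℚ] ℚ := LinearMap.proj x
    let L : ((A → ℚ) × (V → ℚ)) →ₗ[ℚ] ((E → ℚ) × ({x // x ∉ A.biUnion id} → ℚ)) × ℚ :=
      LinearMap.prod (LinearMap.prod
        (LinearMap.pi fun e =>
          ev (q e).2 ∘ₗ LinearMap.proj (φ := fun _ => V → ℚ) (q e).1 ∘ₗ B ∘ₗ LinearMap.fst ℚ _ _ +
          (ev (q e).2 - ev (q e).1) ∘ₗ LinearMap.snd ℚ _ _)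
        (LinearMap.pi fun x => ev x.1 ∘ₗ LinearMap.snd ℚ _ _))
        (ev p ∘ₗ LinearMap.snd ℚ _ _)
    have hL : Function.Injective L := by
      rw [← LinearMap.ker_eq_bot, LinearMap.ker_eq_bot']
      rintro ⟨t, g⟩ ht
      have h1 : ∀ e, B t (q e).1 (q e).2 + (g (q e).2 - g (q e).1) = 0 := fun e =>
        congrFun (congrArg (fun z => z.1.1) ht) e
      have h2 : ∀ x ∉ A.biUnion id, g x = 0 := fun x hx =>
        congrFun (congrArg (fun z => z.1.2) ht) ⟨x, hx⟩
      have h3 : g p = 0 := congrArg (fun z => z.2) ht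
      have hBval : B t = ∑ σ : A, t σ • β σ := by simp [B]
      have hBxy : ∀ x y, B t x y = ∑ σ : A, t σ * β σ x y := fun x y => by
        rw [hBval]; simp [Finset.sum_apply]
      have hBswap : ∀ x y, B t y x = -B t x y := fun x y => by
        simp only [hBxy, hswap _ x y, mul_neg, sum_neg_distrib]
      have hBdiv : ∀ y, ∑ x, B t x y = 0 := fun y => by
        simp only [hBxy]
        rw [sum_comm]
        simp [← mul_sum, hdiv]
      have hBsupp : ∀ x y, B t x y ≠ 0 → {x, y} ∈ E := fun x y hxy => by
        rw [hBxy] at hxy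
        obtain ⟨τ, -, hne⟩ := exists_ne_zero_of_sum_ne_zero hxy
        obtain ⟨h1, h2, h3⟩ := (hsupp τ τ.2 x y).1 fun h0 => hne (by simp [h0])
        exact pair_mem τ τ.2 x y h1 h2 h3
      have hBg : ∀ x y, {x, y} ∈ E → B t x y = g x - g y := by
        intro x y hxy
        have hne := hq ⟨_, hxy⟩
        have h1 := h1 ⟨_, hxy⟩
        have he := hqe ⟨_, hxy⟩
        generalize q ⟨_, hxy⟩ = r at hne h1 he
        obtain ⟨u, v⟩ := r
        simp only at hne h1 he
        have hcases : (x = u ∧ y = v) ∨ (x = v ∧ y = u) := by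
          have hu : u ∈ ({x, y} : Finset V) := he ▸ mem_insert_self u _
          have hv : v ∈ ({x, y} : Finset V) := he ▸ (by simp)
          simp only [mem_insert, mem_singleton] at hu hv
          grind
        obtain ⟨rfl, rfl⟩ | ⟨rfl, rfl⟩ := hcases
        · linarith
        · rw [hBswap]; linarith
      have hsq : ∑ x, ∑ y, B t x y ^ 2 = 0 := by
        have hterm : ∀ x y, B t x y ^ 2 = -(g x * B t y x) - g y * B t x y := fun x y => by
          by_cases hxy : B t x y = 0
          · simp [hBswap x y, hxy]
          · have := hBg x y (hBsupp x y hxy)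
            rw [hBswap x y, sq]
            nth_rewrite 1 [this]
            ring
        simp only [hterm, sum_sub_distrib, sum_neg_distrib, ← mul_sum, hBdiv]
        rw [sum_comm]
        simp [← mul_sum, hBdiv]
      have hB0 : ∀ x y, B t x y = 0 := fun x y => by
        have := (sum_eq_zero_iff_of_nonneg fun x _ => sum_nonneg fun y _ => sq_nonneg _).1 hsq x
          (mem_univ x)
        have := (sum_eq_zero_iff_of_nonneg fun y _ => sq_nonneg _).1 this y (mem_univ y)
        exact pow_eq_zero_iff two_ne_zero |>.1 this
      have hg0 : g = 0 := by
        funext x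
        by_cases hx : x ∈ A.biUnion id
        · obtain ⟨σ, hσ, hxσ⟩ := mem_biUnion.1 hx
          refine hconst g (fun x y hxy => ?_) h3 σ hσ x hxσ
          have := hBg x y hxy
          rw [hB0] at this
          linarith
        · exact h2 x hx
      have ht0 : t = 0 := by
        funext σ
        have key := hind (fun τ => if hτ : τ ∈ A then t ⟨τ, hτ⟩ else 0) (by
          rw [← sum_coe_sort A]
          have : ∑ σ : A, t σ • β σ = 0 := by
            rw [← hBval]; funext x y; exact hB0 x y
          rw [← this]
          exact sum_congr rfl fun σ _ => by simp) σ σ.2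
        simpa using key
      rw [ht0, hg0]
      rfl
    have hrank := LinearMap.finrank_le_finrank_of_injective hL
    simp only [Module.finrank_prod, Module.finrank_fintype_fun_eq_card, Module.finrank_self,
      Fintype.card_coe, Fintype.card_subtype_compl] at hrank
    have := card_le_univ (A.biUnion id)
    omega
  -- double counting of incidences of edges with triangles
  have hdeg : 2 * #E ≤ 3 * #A + 6 := by
    have hcount : ∑ e ∈ E, #{σ ∈ A | e ⊆ σ} = 3 * #A := by
      have h1 := sum_card_bipartiteAbove_eq_sum_card_bipartiteBelow (s := E) (t := A)
        (fun e σ => e ⊆ σ)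
      simp only [bipartiteAbove, bipartiteBelow] at h1
      rw [h1, mul_comm, ← smul_eq_mul, ← sum_const]
      refine sum_congr rfl fun σ hσ => ?_
      have : {e ∈ E | e ⊆ σ} = powersetCard 2 σ := by
        ext e
        simp only [mem_filter, mem_E, mem_powersetCard]
        exact ⟨fun ⟨⟨_, _, _, h2⟩, h1⟩ => ⟨h1, h2⟩, fun ⟨h1, h2⟩ => ⟨⟨σ, hσ, h1, h2⟩, h1⟩⟩
      rw [this, card_powersetCard, hA σ hσ]
      rfl
    have hle : ∀ e ∈ E, 2 ≤ #{σ ∈ A | e ⊆ σ} + if e ∈ H then 1 else 0 := by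
      intro e he
      obtain ⟨σ, hσ, heσ, h2⟩ := (mem_E e).1 he
      have hσe : σ ∈ ({σ ∈ A | e ⊆ σ} : Finset _) := mem_filter.2 ⟨hσ, heσ⟩
      have hpos : 0 < #{σ ∈ A | e ⊆ σ} := card_pos.2 ⟨σ, hσe⟩
      split_ifs with heH
      · omega
      · by_contra! hlt
        obtain ⟨x, y, hxy, rfl⟩ := card_eq_two.1 h2
        have h1 : #{σ ∈ A | {x, y} ⊆ σ} = 1 := by omega
        obtain ⟨σ', hσ'⟩ := card_eq_one.1 h1
        have hσσ' : σ = σ' := by rw [hσ'] at hσe; exact mem_singleton.1 hσe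
        subst hσσ'
        have hβ : β σ x y ≠ 0 :=
          (hsupp σ hσ x y).2 ⟨heσ (by simp), heσ (by simp), hxy⟩
        refine heH (hhH x y ?_)
        rw [← hh, Finset.sum_apply, Finset.sum_apply, sum_eq_single_of_mem σ hσ]
        · exact mul_ne_zero (hc σ hσ) hβ
        · intro τ hτ hne
          have : β τ x y = 0 := by
            by_contra h0
            obtain ⟨h1, h2, -⟩ := (hsupp τ hτ x y).1 h0
            have : τ ∈ ({σ ∈ A | {x, y} ⊆ σ} : Finset _) :=
              mem_filter.2 ⟨hτ, by simp [insert_subset_iff, h1, h2]⟩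
            rw [hσ'] at this
            exact hne (mem_singleton.1 this)
          simp [this]
    have hsum := sum_le_sum hle
    rw [sum_add_distrib, hcount, sum_const, smul_eq_mul, ← sum_filter, sum_const, smul_eq_mul,
      mul_one] at hsum
    have : #{e ∈ E | e ∈ H} ≤ #H := card_le_card fun e he => (mem_filter.1 he).2
    omega
  omega

end Chains

namespace SimplicialComplex2

open Finset

variable {N : ℕ}

/-- If the rational 1-chain `h` is not a boundary in `X` then it is detected by an integral
cocycle. -/
lemma exists_isCocycle {X : SimplicialComplex2 N} {β : Finset (Fin N) → Fin N → Fin N → ℚ}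
    (hβ : ∀ σ, #σ = 3 → ∃ u v w, σ = {u, v, w} ∧ β σ = triangleChain u v w)
    {h : Fin N → Fin N → ℚ}
    (hh : h ∉ Submodule.span ℚ (β '' ({σ ∈ X.faces | #σ = 3} : Finset _))) :
    ∃ (ψ : (Fin N → Fin N → ℚ) →ₗ[ℚ] ℚ) (φ : Fin N → Fin N → ℝ), X.IsCocycle φ ∧ ψ h ≠ 0 ∧
      ∀ u v, φ u v = ψ (edgeChain u v) := by
  obtain ⟨ψ, hψh, hψ⟩ := Submodule.exists_le_ker_of_notMem hh
  obtain ⟨⟨b, hb⟩, hmul⟩ := IsLocalization.exist_integer_multiples_of_finite (nonZeroDivisors ℤ)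
    fun p : Fin N × Fin N => ψ (edgeChain p.1 p.2)
  have hb0 : b ≠ 0 := nonZeroDivisors.ne_zero hb
  have hself : ∀ u : Fin N, edgeChain u u = 0 := fun u => by
    funext x y; simp [edgeChain]
  have hanti : ∀ u v : Fin N, edgeChain v u = -edgeChain u v := fun u v => by
    funext x y; simp [edgeChain]
  have hadd : ∀ u v w, ({u, v, w} : Finset (Fin N)) ∈ X.faces →
      ψ (edgeChain u v) + ψ (edgeChain v w) = ψ (edgeChain u w) := by
    intro u v w hf
    by_cases huv : u = v
    · simp [huv, hself]
    by_cases hvw : v = w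
    · simp [hvw, hself]
    by_cases huw : u = w
    · simp [huw, hself, hanti w v]
    have hcard : #({u, v, w} : Finset (Fin N)) = 3 := card_eq_three.2 ⟨u, v, w, huv, huw, hvw, rfl⟩
    obtain ⟨i, j, k, hσ, hβσ⟩ := hβ _ hcard
    have hker : ψ (β {u, v, w}) = 0 :=
      hψ (Submodule.subset_span ⟨_, mem_coe.2 (mem_filter.2 ⟨hf, hcard⟩), rfl⟩)
    rw [hβσ, triangleChain, map_add, map_add] at hker
    have hu : u ∈ ({i, j, k} : Finset (Fin N)) := hσ ▸ by simp
    have hv : v ∈ ({i, j, k} : Finset (Fin N)) := hσ ▸ by simp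
    have hw : w ∈ ({i, j, k} : Finset (Fin N)) := hσ ▸ by simp
    have hij := congrArg ψ (hanti i j)
    have hjk := congrArg ψ (hanti j k)
    have hki := congrArg ψ (hanti k i)
    rw [map_neg] at hij hjk hki
    simp only [mem_insert, mem_singleton] at hu hv hw
    rcases hu with rfl | rfl | rfl <;> rcases hv with rfl | rfl | rfl <;>
      rcases hw with rfl | rfl | rfl <;> first | contradiction | linarith
  refine ⟨b • ψ, fun u v => ((b • ψ) (edgeChain u v) : ℚ), ⟨fun u => ?_, fun u v w hf => ?_,
    fun u v => ?_⟩, ?_, fun u v => rfl⟩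
  · simp [hself]
  · simp only [LinearMap.smul_apply, ← hadd u v w hf]
    push_cast [smul_add]
    rfl
  · obtain ⟨n, hn⟩ := hmul (u, v)
    refine ⟨n, ?_⟩
    have : (b • ψ) (edgeChain u v) = n := hn.symm
    rw [this]
    simp
  · simpa [hb0] using hψh

/-- A family of triangles with independent boundaries spanning a chain `h`. -/
lemma exists_independent_triangles {T : Finset (Finset (Fin N))}
    {β : Finset (Fin N) → Fin N → Fin N → ℚ} {h : Fin N → Fin N → ℚ}
    (hh : h ∈ Submodule.span ℚ (β '' T)) :
    ∃ A ⊆ T, ∃ c : Finset (Fin N) → ℚ, (∀ σ ∈ A, c σ ≠ 0) ∧ ∑ σ ∈ A, c σ • β σ = h ∧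
      ∀ t : Finset (Fin N) → ℚ, ∑ σ ∈ A, t σ • β σ = 0 → ∀ σ ∈ A, t σ = 0 := by
  obtain ⟨b, hbT, -, hspan, hind⟩ := exists_linearIndepOn_extension (K := ℚ) (v := β)
    (linearIndepOn_empty ℚ β) (Set.empty_subset (T : Set (Finset (Fin N))))
  lift b to Finset (Finset (Fin N)) using T.finite_toSet.subset hbT
  have hhb : h ∈ Submodule.span ℚ (β '' b) := Submodule.span_le.2 hspan hh
  obtain ⟨c, hc⟩ := (Submodule.mem_span_image_finset_iff_exists_fun ℚ).1 hhb
  let c' : Finset (Fin N) → ℚ := fun σ => if hσ : σ ∈ b then c ⟨σ, hσ⟩ else 0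
  refine ⟨{σ ∈ b | c' σ ≠ 0}, (filter_subset _ _).trans (coe_subset.1 hbT), c',
    fun σ hσ => (mem_filter.1 hσ).2, ?_, ?_⟩
  · rw [sum_filter_of_ne (p := fun σ => c' σ ≠ 0) fun σ _ hne h0 => hne (by rw [h0, zero_smul]),
      ← hc, ← sum_coe_sort b]
    exact sum_congr rfl fun σ _ => by simp [c']
  · exact linearIndepOn_finset_iff.1 (hind.mono (coe_subset.2 (filter_subset _ _)))

/-- The subcomplex generated by a family of faces. -/
def closure (X : SimplicialComplex2 N) (A : Finset (Finset (Fin N))) : SimplicialComplex2 N where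
  faces := {τ ∈ X.faces | ∃ σ ∈ A, τ ⊆ σ}
  nonempty_of_mem τ hτ := X.nonempty_of_mem τ (mem_filter.1 hτ).1
  card_le_three τ hτ := X.card_le_three τ (mem_filter.1 hτ).1
  down_closed := by
    intro τ hτ ρ hρ hne
    obtain ⟨hτ, σ, hσ, hτσ⟩ := mem_filter.1 hτ
    exact mem_filter.2 ⟨X.down_closed τ hτ ρ hρ hne, σ, hσ, hρ.trans hτσ⟩

lemma mem_closure {X : SimplicialComplex2 N} {A : Finset (Finset (Fin N))} (hA : A ⊆ X.faces)
    (τ : Finset (Fin N)) : τ ∈ (X.closure A).faces ↔ τ.Nonempty ∧ ∃ σ ∈ A, τ ⊆ σ := by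
  refine mem_filter.trans ⟨fun ⟨h1, h2⟩ => ⟨X.nonempty_of_mem τ h1, h2⟩, fun ⟨h1, h2⟩ => ⟨?_, h2⟩⟩
  obtain ⟨σ, hσ, hτσ⟩ := h2
  exact X.down_closed σ (hA hσ) τ hτσ h1

lemma f_zero_closure {X : SimplicialComplex2 N} {A : Finset (Finset (Fin N))} (hA : A ⊆ X.faces) :
    f 0 (X.closure A) = #(A.biUnion id) := by
  refine Eq.trans (congrArg card ?_) (card_map ⟨_, singleton_injective⟩)
  ext τ
  simp only [mem_filter, mem_closure hA, zero_add, mem_map, mem_biUnion, id_eq,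
    Function.Embedding.coeFn_mk, card_eq_one]
  constructor
  · rintro ⟨⟨-, σ, hσ, hτσ⟩, x, rfl⟩
    exact ⟨x, ⟨σ, hσ, singleton_subset_iff.1 hτσ⟩, rfl⟩
  · rintro ⟨x, ⟨σ, hσ, hx⟩, rfl⟩
    exact ⟨⟨singleton_nonempty x, σ, hσ, singleton_subset_iff.2 hx⟩, x, rfl⟩

lemma f_one_closure {X : SimplicialComplex2 N} {A : Finset (Finset (Fin N))} (hA : A ⊆ X.faces) :
    f 1 (X.closure A) = #(A.biUnion (powersetCard 2)) := by
  rw [f]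
  congr 1
  ext τ
  simp only [mem_filter, mem_closure hA, mem_biUnion, mem_powersetCard]
  constructor
  · rintro ⟨⟨-, σ, hσ, hτσ⟩, h2⟩
    exact ⟨σ, hσ, hτσ, h2⟩
  · rintro ⟨σ, hσ, hτσ, h2⟩
    exact ⟨⟨card_pos.1 (by omega), σ, hσ, hτσ⟩, h2⟩

/-- The 1-chain of a hexagon. -/
def hexChain (p q r a b c : Fin N) : Fin N → Fin N → ℚ :=
  edgeChain p a + (edgeChain a q + (edgeChain q b + (edgeChain b r + (edgeChain r c +
    edgeChain c p))))

lemma hexChain_ne_zero_iff {p q r a b c : Fin N} (h : [p, a, q, b, r, c].Nodup) (x y : Fin N) :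
    hexChain p q r a b c x y ≠ 0 ↔
      ({x, y} : Finset (Fin N)) ∈
        ({{p, a}, {a, q}, {q, b}, {b, r}, {r, c}, {c, p}} : Finset (Finset (Fin N))) := by
  have hpair : ∀ u v : Fin N, ({x, y} : Finset (Fin N)) = {u, v} ↔
      (x = u ∧ y = v) ∨ (x = v ∧ y = u) := fun u v => by
    rw [← coe_inj]
    simp [Set.pair_eq_pair_iff]
  simp only [hexChain, edgeChain, Pi.add_apply, mem_insert, mem_singleton, hpair]
  simp only [List.nodup_cons, List.mem_cons, List.not_mem_nil, or_false, not_or] at h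
  obtain ⟨⟨h1, h2, h3, h4, h5⟩, ⟨h6, h7, h8, h9⟩, ⟨h10, h11, h12⟩, ⟨h13, h14⟩, h15, -⟩ := h
  constructor
  · intro hne
    by_contra hall
    simp only [not_or] at hall
    exact hne (by simp [hall])
  · have s1 := Ne.symm h1
    have s2 := Ne.symm h2
    have s3 := Ne.symm h3
    have s4 := Ne.symm h4
    have s5 := Ne.symm h5
    have s6 := Ne.symm h6
    have s7 := Ne.symm h7
    have s8 := Ne.symm h8
    have s9 := Ne.symm h9
    have s10 := Ne.symm h10
    have s11 := Ne.symm h11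
    have s12 := Ne.symm h12
    have s13 := Ne.symm h13
    have s14 := Ne.symm h14
    have s15 := Ne.symm h15
    clear hpair
    rintro ((⟨rfl, rfl⟩ | ⟨rfl, rfl⟩) | (⟨rfl, rfl⟩ | ⟨rfl, rfl⟩) | (⟨rfl, rfl⟩ | ⟨rfl, rfl⟩) |
      (⟨rfl, rfl⟩ | ⟨rfl, rfl⟩) | (⟨rfl, rfl⟩ | ⟨rfl, rfl⟩) | (⟨rfl, rfl⟩ | ⟨rfl, rfl⟩)) <;>
      simp [*]

lemma eq_of_hexChain_ne_zero {p q r a b c : Fin N} (h : [p, a, q, b, r, c].Nodup)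
    (g : Fin N → ℚ) (hg : ∀ x y, hexChain p q r a b c x y ≠ 0 → g x = g y) (x y : Fin N)
    (hxy : hexChain p q r a b c x y ≠ 0) : g x = g p := by
  have hne := hexChain_ne_zero_iff h
  have g1 := hg p a ((hne _ _).2 (by simp))
  have g2 := hg a q ((hne _ _).2 (by simp))
  have g3 := hg q b ((hne _ _).2 (by simp))
  have g4 := hg b r ((hne _ _).2 (by simp))
  have g5 := hg r c ((hne _ _).2 (by simp))
  have hx : x ∈ ({x, y} : Finset (Fin N)) := by simp
  have hmem := (hne x y).1 hxy
  simp only [mem_insert, mem_singleton] at hmem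
  rcases hmem with h | h | h | h | h | h <;> rw [h] at hx <;>
    simp only [mem_insert, mem_singleton] at hx <;>
    rcases hx with hx | hx <;> rw [hx] <;> linarith

end SimplicialComplex2

open SimplicialComplex2 in
/-- Vertex `i ∈ {1,…,N}` corresponds to the element of `Fin N`
with value `i-1`; so `v₁, v₂, v₃` below are the vertices `1, 2, 3`. -/
theorem hexLoop_not_nullhomotopic {N : ℕ} (X : SimplicialComplex2 N)
    (v₁ v₂ v₃ a b c : Fin N)
    (hv₁ : (v₁ : ℕ) = 0) (hv₂ : (v₂ : ℕ) = 1) (hv₃ : (v₃ : ℕ) = 2)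
    (ha : 3 ≤ (a : ℕ)) (hb : 3 ≤ (b : ℕ)) (hc : 3 ≤ (c : ℕ))
    (hab : a ≠ b) (hbc : b ≠ c) (hac : a ≠ c)
    (e1 : ({v₁, a} : Finset (Fin N)) ∈ X.faces)
    (e2 : ({a, v₂} : Finset (Fin N)) ∈ X.faces)
    (e3 : ({v₂, b} : Finset (Fin N)) ∈ X.faces)
    (e4 : ({b, v₃} : Finset (Fin N)) ∈ X.faces)
    (e5 : ({v₃, c} : Finset (Fin N)) ∈ X.faces)
    (e6 : ({c, v₁} : Finset (Fin N)) ∈ X.faces)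
    (hsparse : ∀ Y : SimplicialComplex2 N, Y.IsSubcomplex X →
      ({v₁} : Finset (Fin N)) ∈ Y.faces → ({v₂} : Finset (Fin N)) ∈ Y.faces →
      ({v₃} : Finset (Fin N)) ∈ Y.faces → 1 ≤ f 1 Y →
      (1 : ℝ) / 3 < ((f 0 Y : ℝ) - 3) / (f 1 Y)) :
    ¬ (hexLoop X v₁ v₂ v₃ a b c e1 e2 e3 e4 e5 e6).Homotopic
        (Path.refl (vertexPt X (edge_fst_mem X e1))) := by
  intro hnull
  have hnodup : [v₁, a, v₂, b, v₃, c].Nodup := by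
    simp only [List.nodup_cons, List.mem_cons, List.not_mem_nil, or_false, not_or, Fin.ext_iff]
      at hab hbc hac ⊢
    simp
    omega
  have hβ : ∀ σ : Finset (Fin N), ∃ β : Fin N → Fin N → ℚ,
      (∃ u v w, β = triangleChain u v w) ∧
      (σ.card = 3 → ∃ u v w, u ≠ v ∧ u ≠ w ∧ v ≠ w ∧ σ = {u, v, w} ∧ β = triangleChain u v w) := by
    intro σ
    by_cases hσ : σ.card = 3
    · obtain ⟨u, v, w, huv, huw, hvw, rfl⟩ := Finset.card_eq_three.1 hσ
      exact ⟨_, ⟨u, v, w, rfl⟩, fun _ => ⟨u, v, w, huv, huw, hvw, rfl, rfl⟩⟩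
    · exact ⟨_, ⟨v₁, v₁, v₁, rfl⟩, fun h => absurd h hσ⟩
  choose β hβtri hβ using hβ
  by_cases hspan : hexChain v₁ v₂ v₃ a b c ∈
      Submodule.span ℚ (β '' ({σ ∈ X.faces | σ.card = 3} : Finset _))
  · obtain ⟨A, hAT, t, ht, hsum, hind⟩ := exists_independent_triangles hspan
    have hAX : A ⊆ X.faces := hAT.trans (Finset.filter_subset _ _)
    have hA3 : ∀ σ ∈ A, σ.card = 3 := fun σ hσ => (Finset.mem_filter.1 (hAT hσ)).2
    have hsupp : ∀ σ ∈ A, ∀ x y, β σ x y ≠ 0 ↔ x ∈ σ ∧ y ∈ σ ∧ x ≠ y := by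
      intro σ hσ x y
      obtain ⟨u, v, w, huv, huw, hvw, h1, h2⟩ := hβ σ (hA3 σ hσ)
      rw [h2, triangleChain_ne_zero_iff huv huw hvw, ← h1]
    have hcount := three_mul_card_vertices_le A hA3 β
      (fun σ x y => by obtain ⟨u, v, w, h⟩ := hβtri σ; rw [h, triangleChain_swap])
      (fun σ y => by obtain ⟨u, v, w, h⟩ := hβtri σ; rw [h, sum_triangleChain])
      hsupp hind t ht _ hsum _ Finset.card_le_six
      (fun x y => (hexChain_ne_zero_iff hnodup x y).1) v₁
      (eq_of_hexChain_ne_zero hnodup)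
    have hedge : ∀ x y, ({x, y} : Finset (Fin N)) ∈
        ({{v₁, a}, {a, v₂}, {v₂, b}, {b, v₃}, {v₃, c}, {c, v₁}} : Finset (Finset (Fin N))) →
        ({x, y} : Finset (Fin N)) ∈ (X.closure A).faces := by
      intro x y hxy
      have hne := (hexChain_ne_zero_iff hnodup x y).2 hxy
      rw [← hsum, Finset.sum_apply, Finset.sum_apply] at hne
      obtain ⟨σ, hσ, h0⟩ := Finset.exists_ne_zero_of_sum_ne_zero hne
      obtain ⟨hx, hy, -⟩ := (hsupp σ hσ x y).1 fun h => h0 (by simp [h])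
      exact (mem_closure hAX _).2 ⟨by simp, σ, hσ, by simp [Finset.insert_subset_iff, hx, hy]⟩
    have hv₁a := hedge v₁ a (by simp)
    have hpos : 1 ≤ f 1 (X.closure A) := by
      refine Finset.card_pos.2 ⟨{v₁, a}, Finset.mem_filter.2 ⟨hv₁a, Finset.card_pair ?_⟩⟩
      rintro rfl
      omega
    have hlt := hsparse (X.closure A) (Finset.filter_subset _ _)
      (edge_fst_mem _ hv₁a) (edge_fst_mem _ (hedge v₂ b (by simp)))
      (edge_fst_mem _ (hedge v₃ c (by simp))) hpos
    rw [div_lt_div_iff₀ (by norm_num) (by exact_mod_cast hpos)] at hlt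
    rw [← f_zero_closure hAX, ← f_one_closure hAX] at hcount
    have : (3 * f 0 (X.closure A) : ℝ) ≤ f 1 (X.closure A) + 9 := by exact_mod_cast hcount
    linarith
  · obtain ⟨ψ, φ, hφ, hψ, hφψ⟩ := exists_isCocycle
      (fun σ hσ => by obtain ⟨u, v, w, -, -, -, h⟩ := hβ σ hσ; exact ⟨u, v, w, h⟩) hspan
    have h0 := hφ.hexLoop_sum_eq_zero e1 e2 e3 e4 e5 e6 hnull
    simp only [hφψ] at h0
    refine hψ ?_
    simp only [hexChain, map_add]
    exact_mod_cast h0
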